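/- Let S be a standard graded Koszul algebra over k and R = S/I with reg_q^S(R) ≤ 1 for some q ≥ 1 (condition N_q). Then t_i^R(k) = i for 1 ≤ i ≤ q + 1; in particular reg_{q+1}^R(k) = 0. -/

import Mathlib

/-- The free graded module with `b j` generators in degree `j` (i.e. `⊕_j A(-j)^{b j}`). -/
abbrev FreeMod (A : Type*) [CommRing A] (b : ℤ → ℕ) : Type _ :=
  ((j : ℤ) × Fin (b j)) →₀ A

/-- A minimal graded free resolution of the module `M` over the (graded) commutative ring `A`,
where `hom m` is the set of homogeneous elements of degree `m` of `A`.  The data records the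
graded Betti numbers `β i j` (the number of copies of `A(-j)` in homological degree `i`),
the differentials and the augmentation; the conditions say that the differentials are graded of
degree `0` (the entries of their matrices are homogeneous of the appropriate degree), that the
resolution is minimal (all entries have positive degree, equivalently lie in the irrelevant
maximal ideal), and that the complex is exact, resolving `M`. -/
structure MinGradedFreeRes (A : Type*) [CommRing A] (hom : ℕ → Set A)
    (M : Type*) [AddCommGroup M] [Module A M] where
  β : ℕ → ℤ → ℕ
  finβ : ∀ i, (Function.support (β i)).Finite
  d : ∀ i, FreeMod A (β (i + 1)) →ₗ[A] FreeMod A (β i)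
  aug : FreeMod A (β 0) →ₗ[A] M
  graded : ∀ (i : ℕ) (j : ℤ) (a : Fin (β (i + 1) j)) (j' : ℤ) (a' : Fin (β i j')),
      d i (Finsupp.single ⟨j, a⟩ 1) ⟨j', a'⟩ = 0 ∨
      ∃ m : ℕ, (m : ℤ) = j - j' ∧ d i (Finsupp.single ⟨j, a⟩ 1) ⟨j', a'⟩ ∈ hom m
  minimal : ∀ (i : ℕ) (j : ℤ) (a : Fin (β (i + 1) j)) (j' : ℤ) (a' : Fin (β i j')),
      d i (Finsupp.single ⟨j, a⟩ 1) ⟨j', a'⟩ ≠ 0 → j' < j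
  augSurj : Function.Surjective aug
  exact₀ : LinearMap.range (d 0) = LinearMap.ker aug
  exact : ∀ i, LinearMap.range (d (i + 1)) = LinearMap.ker (d i)

/-- The `i`-th total Betti number of a resolution. -/
noncomputable def MinGradedFreeRes.tB {A : Type*} [CommRing A] {hom : ℕ → Set A}
    {M : Type*} [AddCommGroup M] [Module A M]
    (res : MinGradedFreeRes A hom M) (i : ℕ) : ℕ :=
  ∑ j ∈ (res.finβ i).toFinset, res.β i j

/-- The height of an ideal: the infimum of the heights of the primes containing it. -/
noncomputable def idealHeight {A : Type*} [CommRing A] (I : Ideal A) : ℕ∞ :=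
  ⨅ (P : PrimeSpectrum A) (_ : I ≤ P.asIdeal), Order.height P

/-- graded ring package -/
structure GrR (A : Type) [CommRing A] where
  gr : ℤ → AddSubgroup A
  π : ℤ → A →+ A
  π_mem : ∀ n x, π n x ∈ gr n
  π_id : ∀ n x, x ∈ gr n → π n x = x
  π_mul : ∀ m n s x, s ∈ gr m → π (m + n) (s * x) = s * π n x
  gr_mul : ∀ m n s x, s ∈ gr m → x ∈ gr n → s * x ∈ gr (m + n)
  one_mem : (1 : A) ∈ gr 0
  neg : ∀ n, n < 0 → ∀ x ∈ gr n, x = 0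

/-- a linear complex of free modules -/
structure KD (S : Type) [CommRing S] (G : GrR S) where
  ι : ℕ → Type
  fin : ∀ m, Fintype (ι m)
  A : ∀ m, ι (m + 1) → ι m → S
  A_mem : ∀ m a b, A m a b ∈ G.gr 1
  AA : ∀ m a c, (Finset.univ (α := ι (m + 1))).sum (fun b => A (m + 1) a b * A m b c) = 0

attribute [instance] KD.fin

namespace KD

variable {S : Type} [CommRing S] {G : GrR S} (K : KD S G)

/-- differential -/
def D {N : Type} [AddCommGroup N] [Module S N] (m : ℕ) (w : K.ι (m + 1) → N) : K.ι m → N :=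
  fun b => ∑ a, K.A m a b • w a

/-- cycles -/
def Cyc {N : Type} [AddCommGroup N] [Module S N] : (m : ℕ) → (K.ι m → N) → Prop
  | 0, _ => True
  | m + 1, z => K.D m z = 0

/-- exactness in homological degree m and internal degree e -/
def E {N : Type} [AddCommGroup N] [Module S N] (gr : ℤ → AddSubgroup N) (m : ℕ) (e : ℤ) : Prop :=
  ∀ z : K.ι m → N, (∀ a, z a ∈ gr e) → K.Cyc m z →
    ∃ w : K.ι (m + 1) → N, (∀ a, w a ∈ gr (e - 1)) ∧ K.D m w = z

section
variable {N : Type} [AddCommGroup N] [Module S N] {N' : Type} [AddCommGroup N'] [Module S N']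
  {F : Type} [AddCommGroup F] [Module S F]

lemma D_map (f : N →ₗ[S] F) (m : ℕ) (w : K.ι (m + 1) → N) :
    K.D m (fun a => f (w a)) = fun b => f (K.D m w b) := by
  funext b; simp [D, map_sum]

lemma D_sub (m : ℕ) (w v : K.ι (m + 1) → N) : K.D m (w - v) = K.D m w - K.D m v := by
  funext b; simp [D, smul_sub, Finset.sum_sub_distrib]

lemma D_zero (m : ℕ) : K.D m (0 : K.ι (m + 1) → N) = 0 := by
  funext b; simp [D]

lemma D_D (m : ℕ) (w : K.ι (m + 2) → N) : K.D m (K.D (m + 1) w) = 0 := by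
  funext c
  simp only [D, Finset.smul_sum, Pi.zero_apply, smul_smul]
  rw [Finset.sum_comm]
  refine Finset.sum_eq_zero fun a _ => ?_
  rw [← Finset.sum_smul]
  have := K.AA m a c
  rw [show (∑ i, K.A m i c * K.A (m + 1) a i) = 0 by
    rw [← this]; exact Finset.sum_congr rfl fun _ _ => mul_comm _ _, zero_smul]

lemma Cyc_D (m : ℕ) (w : K.ι (m + 1) → N) : K.Cyc m (K.D m w) := by
  cases m with
  | zero => trivial
  | succ m => exact K.D_D m w

lemma Cyc_map (f : N →ₗ[S] F) (m : ℕ) (z : K.ι m → N) (h : K.Cyc m z) :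
    K.Cyc m (fun a => f (z a)) := by
  cases m with
  | zero => trivial
  | succ m =>
    change K.D m _ = 0
    rw [D_map, show K.D m z = 0 from h]; funext; simp

lemma Cyc_of_map (f : N →ₗ[S] F) (hf : Function.Injective f) (m : ℕ) (z : K.ι m → N)
    (h : K.Cyc m (fun a => f (z a))) : K.Cyc m z := by
  cases m with
  | zero => trivial
  | succ m =>
    change K.D m _ = 0 at h
    change K.D m _ = 0
    rw [D_map] at h
    funext b
    apply hf
    simpa using congrFun h b

/-- compatibility of grading with degree one scalars -/
def GM (G : GrR S) (gr : ℤ → AddSubgroup N) : Prop :=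
  ∀ (s : S) (n : ℤ) (x : N), s ∈ G.gr 1 → x ∈ gr n → s • x ∈ gr (n + 1)

lemma D_mem {gr : ℤ → AddSubgroup N} (h : GM G gr) (m : ℕ) (n : ℤ) (w : K.ι (m + 1) → N)
    (hw : ∀ a, w a ∈ gr n) (b) : K.D m w b ∈ gr (n + 1) :=
  AddSubgroup.sum_mem _ fun a _ => h _ _ _ (K.A_mem m a b) (hw a)

/-- graded short exact sequences -/
structure SES (gr' : ℤ → AddSubgroup N') (grF : ℤ → AddSubgroup F) (gr : ℤ → AddSubgroup N)
    (f : N' →ₗ[S] F) (g : F →ₗ[S] N) : Prop where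
  inj : Function.Injective f
  mem : ∀ n x, f x ∈ grF n ↔ x ∈ gr' n
  ex : ∀ y, g y = 0 ↔ ∃ x, f x = y
  map : ∀ n y, y ∈ grF n → g y ∈ gr n
  surj : ∀ n y, y ∈ gr n → ∃ x ∈ grF n, g x = y

variable {gr' : ℤ → AddSubgroup N'} {grF : ℤ → AddSubgroup F} {gr : ℤ → AddSubgroup N}
    {f : N' →ₗ[S] F} {g : F →ₗ[S] N}

lemma L1 (h : SES gr' grF gr f g) (hF : GM G grF) (m : ℕ) (e : ℤ)
    (h1 : K.E grF (m + 1) e) (h2 : K.E gr' m (e + 1)) : K.E gr (m + 1) e := by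
  intro z hz hc
  choose y hy hyz using fun a => h.surj e (z a) (hz a)
  have hgy : (fun a => g (y a)) = z := funext hyz
  have hc' : K.D m z = 0 := hc
  have h3 : ∀ b, ∃ x, f x = K.D m y b := fun b => by
    rw [← h.ex]
    have := congrFun (K.D_map g m y) b
    rw [← this, hgy, hc']; rfl
  choose u hu using h3
  have hu' : (fun b => f (u b)) = K.D m y := funext hu
  obtain ⟨v, hv, hvu⟩ := h2 u (fun b => by
    rw [← h.mem, hu]; exact K.D_mem hF m e y hy b)
    (K.Cyc_of_map f h.inj m u (by rw [hu']; exact K.Cyc_D m y))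
  obtain ⟨w, hw, hwy⟩ := h1 (y - fun a => f (v a)) (fun a => by
    refine AddSubgroup.sub_mem _ (hy a) ?_
    rw [h.mem]; simpa using hv a) (by
    change K.D m _ = 0
    rw [D_sub, D_map, hvu, hu', sub_self])
  refine ⟨fun a => g (w a), fun a => h.map _ _ (hw a), ?_⟩
  rw [D_map, hwy]
  funext a
  have : g (f (v a)) = 0 := (h.ex _).2 ⟨_, rfl⟩
  simp [this, hyz]

lemma L2 (h : SES gr' grF gr f g) (hF : GM G grF) (m : ℕ) (e : ℤ)
    (h1 : K.E grF m e) (h2 : K.E gr (m + 1) (e - 1)) : K.E gr' m e := by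
  intro z hz hc
  obtain ⟨w, hw, hwz⟩ := h1 (fun a => f (z a)) (fun a => (h.mem _ _).2 (hz a))
    (K.Cyc_map f m z hc)
  obtain ⟨v', hv', hvw⟩ := h2 (fun a => g (w a)) (fun a => h.map _ _ (hw a)) (by
    change K.D m _ = 0
    rw [D_map, hwz]
    funext a
    exact (h.ex _).2 ⟨_, rfl⟩)
  choose v hv hgv using fun a => h.surj _ (v' a) (hv' a)
  have hgv' : (fun a => g (v a)) = v' := funext hgv
  have h3 : ∀ b, ∃ x, f x = (w - K.D (m + 1) v) b := fun b => by
    rw [← h.ex]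
    have := congrFun (K.D_map g (m + 1) v) b
    rw [Pi.sub_apply, map_sub, ← this, hgv', hvw, sub_self]
  choose u hu using h3
  have hu' : (fun b => f (u b)) = w - K.D (m + 1) v := funext hu
  refine ⟨u, fun b => ?_, ?_⟩
  · rw [← h.mem, hu]
    refine AddSubgroup.sub_mem _ (hw b) ?_
    have := K.D_mem hF (m + 1) _ v hv b
    simpa using this
  · funext b
    apply h.inj
    have h4 := K.D_map f m u
    rw [hu', D_sub, D_D, sub_zero, hwz] at h4
    exact (congrFun h4 b).symm

lemma E_image (hF : SES gr' grF gr f g) (e : ℤ) (h1 : K.E grF 0 e) : K.E gr 0 e := by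
  intro z hz _
  choose y hy hyz using fun a => hF.surj e (z a) (hz a)
  obtain ⟨w, hw, hwy⟩ := h1 y hy trivial
  refine ⟨fun a => g (w a), fun a => hF.map _ _ (hw a), ?_⟩
  rw [D_map, hwy]; funext a; exact hyz a

lemma E_bot (m : ℕ) (e : ℤ) (h : ∀ x ∈ gr e, x = 0) : K.E gr m e := by
  intro z hz _
  refine ⟨0, fun a => AddSubgroup.zero_mem _, ?_⟩
  rw [D_zero]; funext a; exact (h _ (hz a)).symm

end

end KD

/-- grading on free modules -/
def fgr {A : Type} [CommRing A] (P : GrR A) (b : ℤ → ℕ) (n : ℤ) : AddSubgroup (FreeMod A b) where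
  carrier := {x | ∀ t, x t ∈ P.gr (n - t.1)}
  zero_mem' := fun _ => AddSubgroup.zero_mem _
  add_mem' := fun hx hy t => AddSubgroup.add_mem _ (hx t) (hy t)
  neg_mem' := fun hx t => AddSubgroup.neg_mem _ (hx t)

lemma finite_idx (b : ℤ → ℕ) (h : (Function.support b).Finite) : Finite ((j : ℤ) × Fin (b j)) := by
  have := h.to_subtype
  refine Finite.of_injective
    (β := (j : Function.support b) × Fin (b j))
    (fun t => ⟨⟨t.1, by have := t.2.pos; simp [Function.mem_support]; omega⟩, t.2⟩) ?_
  rintro ⟨j, a⟩ ⟨j', a'⟩ h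
  simp only [Sigma.mk.injEq, Subtype.mk.injEq] at h
  obtain ⟨rfl, h⟩ := h
  simpa using h

section
variable {S : Type} [CommRing S] {G : GrR S} (K : KD S G)
variable {A : Type} [CommRing A] [Algebra S A] (P : GrR A)

lemma GM_fgr (hP : KD.GM G P.gr) (b : ℤ → ℕ) : KD.GM G (fgr P b) := by
  intro s n x hs hx t
  have := hP s _ _ hs (hx t)
  rw [show n - t.1 + 1 = n + 1 - t.1 by ring] at this
  simpa using this

lemma E_free (b : ℤ → ℕ) (hb : (Function.support b).Finite) (m : ℕ) (e : ℤ)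
    (h : ∀ j, b j ≠ 0 → K.E P.gr m (e - j)) : K.E (fgr P b) m e := by
  have := finite_idx b hb
  intro z hz hc
  have h1 : ∀ t : (j : ℤ) × Fin (b j), ∃ w : K.ι (m + 1) → A,
      (∀ a, w a ∈ P.gr (e - t.1 - 1)) ∧ K.D m w = fun a => z a t := by
    intro t
    refine h t.1 (by have := t.2.pos; omega) _ (fun a => hz a t) ?_
    exact K.Cyc_map (Finsupp.lapply (R := S) (M := A) t) m z hc
  choose w hw hwz using h1
  refine ⟨fun a => Finsupp.equivFunOnFinite.symm fun t => w t a, fun a t => ?_, ?_⟩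
  · have := hw t a
    rw [show e - t.1 - 1 = e - 1 - t.1 by ring] at this
    simpa using this
  · funext a
    ext t
    have := congrFun (hwz t) a
    simp only [KD.D] at this ⊢
    rw [← this, Finsupp.finsetSum_apply]
    simp
end

section
variable {A : Type} [CommRing A] {hom : ℕ → Set A} {M : Type} [AddCommGroup M] [Module A M]
  (res : MinGradedFreeRes A hom M) (P : GrR A) 

lemma d_apply {b b' : ℤ → ℕ} [Fintype ((j : ℤ) × Fin (b j))]
    (d : FreeMod A b →ₗ[A] FreeMod A b') (v : FreeMod A b) (t') :
    d v t' = ∑ t, v t * d (Finsupp.single t 1) t' := by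
  conv_lhs => rw [← Finsupp.univ_sum_single v]
  rw [map_sum, Finsupp.finsetSum_apply]
  refine Finset.sum_congr rfl fun t _ => ?_
  rw [show Finsupp.single t (v t) = v t • Finsupp.single t (1 : A) by simp, map_smul]
  simp

lemma d_mem {b b' : ℤ → ℕ} (hb : (Function.support b).Finite)
    (d : FreeMod A b →ₗ[A] FreeMod A b')
    (hd : ∀ t t', d (Finsupp.single t 1) t' ∈ P.gr (t.1 - t'.1)) (n : ℤ) (x : FreeMod A b)
    (hx : x ∈ fgr P b n) : d x ∈ fgr P b' n := by
  have := finite_idx b hb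
  have := Fintype.ofFinite ((j : ℤ) × Fin (b j))
  intro t'
  rw [d_apply]
  refine AddSubgroup.sum_mem _ fun t _ => ?_
  have := P.gr_mul _ _ _ _ (hx t) (hd t t')
  rwa [show n - t.1 + (t.1 - t'.1) = n - t'.1 by ring] at this

lemma d_strict {b b' : ℤ → ℕ} (hb : (Function.support b).Finite)
    (d : FreeMod A b →ₗ[A] FreeMod A b')
    (hd : ∀ t t', d (Finsupp.single t 1) t' ∈ P.gr (t.1 - t'.1)) (n : ℤ) (x : FreeMod A b)
    (hx : d x ∈ fgr P b' n) : ∃ y ∈ fgr P b n, d y = d x := by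
  have := finite_idx b hb
  have := Fintype.ofFinite ((j : ℤ) × Fin (b j))
  refine ⟨Finsupp.equivFunOnFinite.symm fun t => P.π (n - t.1) (x t), fun t => ?_, ?_⟩
  · simpa using P.π_mem _ _
  · ext t'
    rw [← P.π_id _ _ (hx t'), d_apply, d_apply d x, map_sum]
    refine Finset.sum_congr rfl fun t _ => ?_
    have := P.π_mul (t.1 - t'.1) (n - t.1) _ (x t) (hd t t')
    rw [show t.1 - t'.1 + (n - t.1) = n - t'.1 by ring] at this
    rw [mul_comm (x t), this, mul_comm]
    simp

variable {S : Type} [CommRing S] [Algebra S A]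

/-- syzygies -/
noncomputable def Zs (S : Type) [CommRing S] [Algebra S A] (i : ℕ) : Submodule S (FreeMod A (res.β i)) :=
  (LinearMap.range (res.d i)).restrictScalars S

/-- grading on syzygies -/
noncomputable def Zgr (S : Type) [CommRing S] [Algebra S A] (i : ℕ) (n : ℤ) : AddSubgroup (Zs res S i) :=
  (fgr P (res.β i) n).comap (Zs res S i).subtype.toAddMonoidHom

/-- the surjection onto the syzygy -/
noncomputable def gs (S : Type) [CommRing S] [Algebra S A] (i : ℕ) :
    FreeMod A (res.β (i + 1)) →ₗ[S] Zs res S i :=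
  ((res.d i).restrictScalars S).codRestrict (Zs res S i) fun c => ⟨c, rfl⟩

/-- entries are graded -/
def Hgr : Prop := ∀ i t t', res.d i (Finsupp.single t 1) t' ∈ P.gr (t.1 - t'.1)

lemma ses_res (hd : Hgr res P) (i : ℕ) :
    KD.SES (S := S) (Zgr res P S (i + 1)) (fgr P (res.β (i + 1))) (Zgr res P S i)
      (Zs res S (i + 1)).subtype (gs res S i) where
  inj := Subtype.val_injective
  mem := fun n x => Iff.rfl
  ex := fun y => by
    have h : gs res S i y = 0 ↔ y ∈ LinearMap.ker (res.d i) := by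
      rw [LinearMap.mem_ker, ← Subtype.coe_inj]; rfl
    rw [h, ← res.exact i]
    constructor
    · intro hy; exact ⟨⟨y, hy⟩, rfl⟩
    · rintro ⟨x, rfl⟩; exact x.2
  map := fun n y hy => d_mem P (res.finβ _) _ (hd i) n y hy
  surj := by
    rintro n ⟨_, ⟨x, rfl⟩⟩ hy
    obtain ⟨y, hy, hyx⟩ := d_strict P (res.finβ _) _ (hd i) n x hy
    exact ⟨y, hy, Subtype.ext hyx⟩

lemma ses_zero {N : Type} [AddCommGroup N] [Module S N] (gr : ℤ → AddSubgroup N)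
    (g : FreeMod A (res.β 0) →ₗ[S] N) (hg : ∀ y, g y = 0 ↔ res.aug y = 0)
    (map : ∀ n y, y ∈ fgr P (res.β 0) n → g y ∈ gr n)
    (surj : ∀ n y, y ∈ gr n → ∃ x ∈ fgr P (res.β 0) n, g x = y) :
    KD.SES (S := S) (Zgr res P S 0) (fgr P (res.β 0)) gr (Zs res S 0).subtype g where
  inj := Subtype.val_injective
  mem := fun n x => Iff.rfl
  ex := fun y => by
    rw [hg, ← LinearMap.mem_ker, ← res.exact₀]
    constructor
    · intro hy; exact ⟨⟨y, hy⟩, rfl⟩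
    · rintro ⟨x, rfl⟩; exact x.2
  map := map
  surj := surj

/-- coordinates of boundaries are killed by the augmentation -/
lemma range_aug (res : MinGradedFreeRes A hom M) {k : Type} [Field k] (ε : A →+* k)
    (hε : ∀ m, 1 ≤ m → ∀ x ∈ hom m, ε x = 0) (i : ℕ) (v : FreeMod A (res.β (i + 1))) (t') :
    ε (res.d i v t') = 0 := by
  have := finite_idx _ (res.finβ (i + 1))
  have := Fintype.ofFinite ((j : ℤ) × Fin (res.β (i + 1) j))
  rw [d_apply, map_sum]
  refine Finset.sum_eq_zero fun t _ => ?_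
  rw [map_mul]
  by_cases h0 : res.d i (Finsupp.single t 1) t' = 0
  · rw [h0]; simp
  · have h1 := res.minimal i t.1 t.2 t'.1 t'.2 h0
    rcases res.graded i t.1 t.2 t'.1 t'.2 with h | ⟨m, hm, h⟩
    · exact absurd h h0
    · rw [hε m (by omega) _ h, mul_zero]

lemma lower (res : MinGradedFreeRes A hom M) {k : Type} [Field k] (ε : A →+* k)
    (hε : ∀ m, 1 ≤ m → ∀ x ∈ hom m, ε x = 0) (h0 : ∀ j, res.β 0 j ≠ 0 → j = 0) (i : ℕ) :
    ∀ j, res.β i j ≠ 0 → (i : ℤ) ≤ j := by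
  induction i with
  | zero => intro j hj; have := h0 j hj; simp [this]
  | succ i ih =>
    intro j hj
    let a : Fin (res.β (i + 1) j) := ⟨0, by omega⟩
    have hne : res.d i (Finsupp.single ⟨j, a⟩ 1) ≠ 0 := by
      intro h
      rw [← LinearMap.mem_ker, ← res.exact i] at h
      obtain ⟨v, hv⟩ := h
      have := range_aug res ε hε (i + 1) v ⟨j, a⟩
      rw [hv] at this
      simp at this
    obtain ⟨t', ht'⟩ := Finsupp.ne_iff.1 hne
    have h1 := res.minimal i j a t'.1 t'.2 ht'
    have := ih t'.1 (by have := t'.2.pos; omega)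
    push_cast; omega

lemma beta_zero {G : GrR S} (K : KD S G) (hK : Nonempty (K.ι 0))
    (res : MinGradedFreeRes A hom M) {k : Type} [Field k] (ε : A →+* k)
    (hε : ∀ m, 1 ≤ m → ∀ x ∈ hom m, ε x = 0) (hd : Hgr res P) (i : ℕ) (e : ℤ)
    (h : K.E (Zgr res P S i) 0 e) : res.β (i + 1) e = 0 := by
  by_contra hj
  let a : Fin (res.β (i + 1) e) := ⟨0, by omega⟩
  let t : (j : ℤ) × Fin (res.β (i + 1) j) := ⟨e, a⟩
  have hses := ses_res (S := S) res P hd i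
  have hx : (Finsupp.single t 1 : FreeMod A (res.β (i + 1))) ∈ fgr P (res.β (i + 1)) e := by
    intro s
    by_cases hs : t = s
    · subst hs
      simpa [t] using P.one_mem
    · rw [Finsupp.single_eq_of_ne' hs]; exact AddSubgroup.zero_mem _
  obtain ⟨w, hw, hwz⟩ := h (fun _ => gs res S i (Finsupp.single t 1)) (fun _ => hses.map _ _ hx)
    trivial
  choose y hy hyw using fun a => hses.surj _ (w a) (hw a)
  obtain ⟨c⟩ := hK
  have h1 : gs res S i (K.D 0 y c - Finsupp.single t 1) = 0 := by
    have h5 := congrFun (K.D_map (N := FreeMod A (res.β (i + 1))) (F := Zs res S i)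
      (gs res S i) 0 y) c
    rw [show (fun a => gs res S i (y a)) = w from funext hyw, hwz] at h5
    rw [map_sub, sub_eq_zero]
    exact h5.symm
  obtain ⟨⟨_, ⟨v, rfl⟩⟩, hv⟩ := (hses.ex _).1 h1
  have h2 := range_aug res ε hε (i + 1) v t
  have h3 : res.d (i + 1) v = K.D 0 y c - Finsupp.single t 1 := hv
  have h4 : K.D 0 y c t = 0 := by
    simp only [KD.D]
    rw [Finsupp.finsetSum_apply]
    refine Finset.sum_eq_zero fun a _ => ?_
    have := P.neg (e - 1 - t.1) (by simp [t]) _ (hy a t)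
    rw [Finsupp.smul_apply, this, smul_zero]
  rw [h3, Finsupp.sub_apply, h4] at h2
  simp at h2

/-- the main induction over R -/
lemma main_ind {G : GrR S} (K : KD S G) (hK : Nonempty (K.ι 0))
    (res : MinGradedFreeRes A hom M) {k : Type} [Field k] (ε : A →+* k)
    (hε : ∀ m, 1 ≤ m → ∀ x ∈ hom m, ε x = 0) (hd : Hgr res P) (hGM : KD.GM G P.gr) (q : ℕ)
    (hR : ∀ m e, m ≤ q → 1 < e → K.E P.gr m e)
    (h0 : ∀ j, res.β 0 j ≠ 0 → j = 0)
    {N : Type} [AddCommGroup N] [Module S N] (gr : ℤ → AddSubgroup N)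
    (g : FreeMod A (res.β 0) →ₗ[S] N)
    (hses : KD.SES (S := S) (Zgr res P S 0) (fgr P (res.β 0)) gr (Zs res S 0).subtype g)
    (hN : ∀ n, 0 < n → ∀ x ∈ gr n, x = 0) (i : ℕ) :
    ∀ m e, m + i ≤ q → (i : ℤ) + 1 < e → K.E (Zgr res P S i) m e := by
  induction i with
  | zero =>
    intro m e hm he
    refine K.L2 hses (GM_fgr P hGM _) m e (E_free K P _ (res.finβ _) m e fun j hj => ?_)
      (K.E_bot _ _ (hN _ (by push_cast at he; omega)))
    rw [h0 j hj]
    exact hR _ _ (by omega) (by push_cast at he; omega)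
  | succ i ih =>
    intro m e hm he
    push_cast at he
    refine K.L2 (ses_res res P hd i) (GM_fgr P hGM _) m e
      (E_free K P _ (res.finβ _) m e fun j hj => ?_) (ih _ _ (by omega) (by omega))
    refine hR _ _ (by omega) ?_
    by_contra hcon
    exact hj (beta_zero P K hK res ε hε hd i j (ih 0 j (by omega) (by omega)))

end

/-- exactness for R from its resolution over S -/
lemma ind_R {S : Type} [CommRing S] {hom : ℕ → Set S} {M : Type} [AddCommGroup M] [Module S M]
    (res : MinGradedFreeRes S hom M) (G : GrR S) (K : KD S G) (hd : Hgr res G)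
    (hGM : KD.GM G G.gr) (hS : ∀ m e, (m ≠ 0 ∨ e ≠ 0) → K.E G.gr m e) (m : ℕ) :
    ∀ i e, res.β (i + m + 1) (e + m) = 0 → K.E (Zgr res G S i) m e := by
  induction m with
  | zero =>
    intro i e h
    refine K.E_image (ses_res res G hd i) e (E_free K G _ (res.finβ _) 0 e fun j hj => ?_)
    refine hS _ _ (Or.inr ?_)
    rintro h'
    have : e = j := by omega
    subst this
    simp at h; exact hj h
  | succ m ih =>
    intro i e h
    refine K.L1 (ses_res res G hd i) (GM_fgr G hGM _) m e
      (E_free K G _ (res.finβ _) _ e fun j hj => hS _ _ (Or.inl (by omega))) (ih _ _ ?_)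
    rw [← h]; congr 1
    · congr 1; omega
    · push_cast; ring

section
variable {k : Type} [Field k] {S : Type} [CommRing S] [Algebra k S]
    (𝒜 : ℕ → Submodule k S) [GradedAlgebra 𝒜]

/-- the integer graded pieces -/
def zgr (n : ℤ) : AddSubgroup S := if 0 ≤ n then (𝒜 n.toNat).toAddSubgroup else ⊥

lemma zgr_nat (n : ℕ) (x : S) : x ∈ zgr 𝒜 n ↔ x ∈ 𝒜 n := by
  simp [zgr]

lemma zgr_neg (n : ℤ) (hn : n < 0) (x : S) (h : x ∈ zgr 𝒜 n) : x = 0 := by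
  simpa [zgr, not_le.2 hn] using h

/-- the projections -/
noncomputable def zpi (n : ℤ) : S →+ S := if 0 ≤ n then GradedRing.proj 𝒜 n.toNat else 0

lemma zpi_nat (n : ℕ) (x : S) : zpi 𝒜 n x = DirectSum.decompose 𝒜 x n := by
  simp [zpi, GradedRing.proj_apply]

lemma zpi_neg (n : ℤ) (hn : n < 0) (x : S) : zpi 𝒜 n x = 0 := by
  simp [zpi, not_le.2 hn]

lemma int_cases (n : ℤ) : (∃ m : ℕ, n = m) ∨ n < 0 := by
  rcases lt_or_ge n 0 with h | h
  · exact Or.inr h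
  · exact Or.inl ⟨n.toNat, by omega⟩

/-- package for S -/
noncomputable def GS : GrR S where
  gr := zgr 𝒜
  π := zpi 𝒜
  π_mem := fun n x => by
    rcases int_cases n with ⟨m, rfl⟩ | h
    · rw [zgr_nat, zpi_nat]; exact SetLike.coe_mem _
    · rw [zpi_neg 𝒜 n h]; exact AddSubgroup.zero_mem _
  π_id := fun n x hx => by
    rcases int_cases n with ⟨m, rfl⟩ | h
    · rw [zgr_nat] at hx; rw [zpi_nat]; exact DirectSum.decompose_of_mem_same 𝒜 hx
    · rw [zgr_neg 𝒜 n h x hx, map_zero]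
  π_mul := fun m n s x hs => by
    rcases int_cases m with ⟨m, rfl⟩ | h
    · rw [zgr_nat] at hs
      rcases int_cases n with ⟨n, rfl⟩ | h
      · rw [← Nat.cast_add, zpi_nat, zpi_nat]
        exact DirectSum.coe_decompose_mul_add_of_left_mem 𝒜 hs
      · rw [zpi_neg 𝒜 n h, mul_zero]
        rcases int_cases (m + n) with ⟨l, hl⟩ | h
        · rw [hl, zpi_nat]
          exact DirectSum.coe_decompose_mul_of_left_mem_of_not_le 𝒜 hs (by omega)
        · rw [zpi_neg 𝒜 _ h]
    · rw [zgr_neg 𝒜 m h s hs]; simp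
  gr_mul := fun m n s x hs hx => by
    rcases int_cases m with ⟨m, rfl⟩ | h
    · rcases int_cases n with ⟨n, rfl⟩ | h
      · rw [zgr_nat] at hs hx
        rw [← Nat.cast_add, zgr_nat]
        exact SetLike.mul_mem_graded hs hx
      · rw [zgr_neg 𝒜 n h x hx, mul_zero]; exact AddSubgroup.zero_mem _
    · rw [zgr_neg 𝒜 m h s hs, zero_mul]; exact AddSubgroup.zero_mem _
  one_mem := (zgr_nat 𝒜 0 1).2 (SetLike.one_mem_graded 𝒜)
  neg := zgr_neg 𝒜

variable (I : Ideal S)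

lemma zpi_I (hI : Ideal.IsHomogeneous 𝒜 I) (n : ℤ) (x : S) (hx : x ∈ I) : zpi 𝒜 n x ∈ I := by
  rcases int_cases n with ⟨m, rfl⟩ | h
  · rw [zpi_nat]; exact hI m hx
  · rw [zpi_neg 𝒜 n h]; exact I.zero_mem

variable (hI : Ideal.IsHomogeneous 𝒜 I)

/-- projections on the quotient -/
noncomputable def qpi (n : ℤ) : S ⧸ I →+ S ⧸ I :=
  QuotientAddGroup.map I.toAddSubgroup I.toAddSubgroup (zpi 𝒜 n) (fun x hx => zpi_I 𝒜 I hI n x hx)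

lemma qpi_mk (n : ℤ) (x : S) :
    qpi 𝒜 I hI n (Ideal.Quotient.mk I x) = Ideal.Quotient.mk I (zpi 𝒜 n x) := rfl

/-- package for the quotient -/
noncomputable def GQ : GrR (S ⧸ I) where
  gr := fun n => (zgr 𝒜 n).map (Ideal.Quotient.mk I).toAddMonoidHom
  π := qpi 𝒜 I hI
  π_mem := fun n x => by
    obtain ⟨x, rfl⟩ := Ideal.Quotient.mk_surjective x
    exact ⟨_, (GS 𝒜).π_mem n x, rfl⟩
  π_id := by
    rintro n _ ⟨x, hx, rfl⟩
    exact congrArg (Ideal.Quotient.mk I) ((GS 𝒜).π_id n x hx)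
  π_mul := by
    rintro m n _ x ⟨s, hs, rfl⟩
    obtain ⟨x, rfl⟩ := Ideal.Quotient.mk_surjective x
    exact congrArg (Ideal.Quotient.mk I) ((GS 𝒜).π_mul m n s x hs)
  gr_mul := by
    rintro m n _ _ ⟨s, hs, rfl⟩ ⟨x, hx, rfl⟩
    exact ⟨s * x, (GS 𝒜).gr_mul m n s x hs hx, map_mul (Ideal.Quotient.mk I) _ _⟩
  one_mem := ⟨1, (GS 𝒜).one_mem, map_one (Ideal.Quotient.mk I)⟩
  neg := by
    rintro n hn _ ⟨x, hx, rfl⟩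
    rw [zgr_neg 𝒜 n hn x hx]; exact map_zero _

lemma Hgr_S {M : Type} [AddCommGroup M] [Module S M]
    (res : MinGradedFreeRes S (fun m => (𝒜 m : Set S)) M) : Hgr res (GS 𝒜) := by
  intro i t t'
  rcases res.graded i t.1 t.2 t'.1 t'.2 with h | ⟨m, hm, h⟩
  · change res.d i (Finsupp.single t 1) t' = 0 at h
    rw [h]; exact AddSubgroup.zero_mem _
  · rw [← hm]; exact (zgr_nat 𝒜 m _).2 h

lemma Hgr_Q {M : Type} [AddCommGroup M] [Module (S ⧸ I) M]
    (res : MinGradedFreeRes (S ⧸ I) (fun m => (Ideal.Quotient.mk I) '' (𝒜 m : Set S)) M) :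
    Hgr res (GQ 𝒜 I hI) := by
  intro i t t'
  rcases res.graded i t.1 t.2 t'.1 t'.2 with h | ⟨m, hm, y, hy, h⟩
  · change res.d i (Finsupp.single t 1) t' = 0 at h
    rw [h]; exact AddSubgroup.zero_mem _
  · rw [← hm]; exact ⟨y, (zgr_nat 𝒜 m _).2 hy, h⟩

lemma GM_S : KD.GM (GS 𝒜) (GS 𝒜).gr := fun s n x hs hx => by
  rw [add_comm]; exact (GS 𝒜).gr_mul _ _ _ _ hs hx

lemma GM_Q : KD.GM (GS 𝒜) (GQ 𝒜 I hI).gr := by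
  rintro s n _ hs ⟨x, hx, rfl⟩
  exact ⟨s * x, GM_S 𝒜 s n x hs hx, rfl⟩

/-- the linear complex from the Koszul resolution -/
noncomputable def KK {M : Type} [AddCommGroup M] [Module S M]
    (res : MinGradedFreeRes S (fun m => (𝒜 m : Set S)) M)
    (hlin : ∀ (i : ℕ) (j : ℤ), res.β i j ≠ 0 → j = (i : ℤ)) : KD S (GS 𝒜) where
  ι := fun m => (j : ℤ) × Fin (res.β m j)
  fin := fun m => by
    have := finite_idx _ (res.finβ m)
    exact Fintype.ofFinite _
  A := fun m a b => res.d m (Finsupp.single a 1) b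
  A_mem := fun m a b => by
    have h := Hgr_S 𝒜 res m a b
    have h1 := hlin (m + 1) a.1 (by have := a.2.pos; omega)
    have h2 := hlin m b.1 (by have := b.2.pos; omega)
    rwa [show a.1 - b.1 = 1 by rw [h1, h2]; push_cast; ring] at h
  AA := fun m a c => by
    have := finite_idx _ (res.finβ (m + 1))
    let _ := Fintype.ofFinite ((j : ℤ) × Fin (res.β (m + 1) j))
    have h := d_apply (res.d m) (res.d (m + 1) (Finsupp.single a 1)) c
    have h2 : res.d (m + 1) (Finsupp.single a 1) ∈ LinearMap.ker (res.d m) := by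
      rw [← res.exact m]; exact ⟨_, rfl⟩
    rw [LinearMap.mem_ker.1 h2] at h
    exact h.symm

lemma KK_D {M : Type} [AddCommGroup M] [Module S M]
    (res : MinGradedFreeRes S (fun m => (𝒜 m : Set S)) M)
    (hlin : ∀ (i : ℕ) (j : ℤ), res.β i j ≠ 0 → j = (i : ℤ)) (m : ℕ)
    (v : FreeMod S (res.β (m + 1))) :
    (KK 𝒜 res hlin).D m (fun a => v a) = fun b => res.d m v b := by
  let _ := (KK 𝒜 res hlin).fin (m + 1)
  funext b
  exact (Finset.sum_congr rfl fun _ _ => mul_comm _ _).trans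
    (@d_apply _ _ _ _ ((KK 𝒜 res hlin).fin (m + 1)) (res.d m) v b).symm

lemma KK_E {M : Type} [AddCommGroup M] [Module S M]
    (res : MinGradedFreeRes S (fun m => (𝒜 m : Set S)) M)
    (hlin : ∀ (i : ℕ) (j : ℤ), res.β i j ≠ 0 → j = (i : ℤ))
    (hM : ∀ m, 1 ≤ m → ∀ s ∈ 𝒜 m, ∀ x : M, s • x = 0) (m : ℕ) (e : ℤ) (h : m ≠ 0 ∨ e ≠ 0) :
    (KK 𝒜 res hlin).E (GS 𝒜).gr m e := by
  intro z hz hc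
  have := finite_idx _ (res.finβ m)
  have := finite_idx _ (res.finβ (m + 1))
  let _ := Fintype.ofFinite ((j : ℤ) × Fin (res.β m j))
  let zz : FreeMod S (res.β m) := Finsupp.equivFunOnFinite.symm z
  have hzz : ∀ a, zz a = z a := fun a => rfl
  have hr : zz ∈ LinearMap.range (res.d m) := by
    cases m with
    | zero =>
      rw [res.exact₀, LinearMap.mem_ker, ← Finsupp.univ_sum_single zz, map_sum]
      refine Finset.sum_eq_zero fun t _ => ?_
      rw [show Finsupp.single t (zz t) = zz t • Finsupp.single t (1 : S) by simp, map_smul]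
      have h1 := hz t
      rcases int_cases e with ⟨n, rfl⟩ | h
      · exact hM n (by simp at h; omega) _ ((zgr_nat 𝒜 n _).1 h1) _
      · rw [hzz, zgr_neg 𝒜 e h _ h1, zero_smul]
    | succ m =>
      rw [res.exact m, LinearMap.mem_ker]
      have h1 := KK_D 𝒜 res hlin m zz
      have h2 : (KK 𝒜 res hlin).D m z = 0 := hc
      ext b
      exact (congrFun h1 b).symm.trans (congrFun h2 b)
  obtain ⟨v, hv⟩ := hr
  obtain ⟨y, hy, hyv⟩ := d_strict (GS 𝒜) (res.finβ (m + 1)) (res.d m) (Hgr_S 𝒜 res m) (e + m) v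
    (by
      rw [hv]
      intro t
      rw [hlin m t.1 (by have := t.2.pos; omega)]
      rw [add_sub_cancel_right]
      exact hz t)
  refine ⟨fun a => y a, fun a => ?_, ?_⟩
  · have h1 := hy a
    rw [hlin (m + 1) a.1 (by have := a.2.pos; omega)] at h1
    rwa [show e + m - ((m + 1 : ℕ) : ℤ) = e - 1 by push_cast; ring] at h1
  · rw [KK_D, hyv, hv]; rfl

end

lemma idx_unique (b : ℤ → ℕ) (h : ∀ j : ℤ, b j = if j = 0 then 1 else 0) :
    ∃ t0 : (j : ℤ) × Fin (b j), t0.1 = 0 ∧ ∀ t, t = t0 := by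
  have h0 : b 0 = 1 := by simp [h]
  refine ⟨⟨0, ⟨0, by omega⟩⟩, rfl, ?_⟩
  rintro ⟨j, a⟩
  have hj : j = 0 := by
    by_contra hj
    have := a.pos
    rw [h, if_neg hj] at this
    omega
  subst hj
  congr 1
  ext
  have := a.2
  simp only
  omega

lemma aug_eq {A : Type} [CommRing A] {M : Type} [AddCommGroup M] [Module A M] {b : ℤ → ℕ}
    (aug : FreeMod A b →ₗ[A] M) (t0 : (j : ℤ) × Fin (b j)) (ht : ∀ t, t = t0) (y : FreeMod A b) :
    aug y = y t0 • aug (Finsupp.single t0 1) := by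
  rw [← map_smul]
  congr 1
  ext t
  rw [ht t]
  simp

lemma fgr_single {A : Type} [CommRing A] (P : GrR A) {b : ℤ → ℕ} (t0 : (j : ℤ) × Fin (b j))
    (h0 : t0.1 = 0) (ht : ∀ t, t = t0) (n : ℤ) (x : A) (hx : x ∈ P.gr n) :
    (Finsupp.single t0 x : FreeMod A b) ∈ fgr P b n := by
  intro t
  rw [ht t, h0, sub_zero]
  simpa using hx

theorem core
    (k : Type) [Field k] (S : Type) [CommRing S] [Algebra k S]
    (𝒜 : ℕ → Submodule k S) [GradedAlgebra 𝒜]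
    (ε : S →ₐ[k] k) (hε : ∀ m, 1 ≤ m → ∀ x ∈ 𝒜 m, ε x = 0)
    (I : Ideal S) (hI : Ideal.IsHomogeneous 𝒜 I)
    (hIε : ∀ a ∈ I, ε a = 0)
    (q : ℕ)
    [Module S k] (hS : ∀ (s : S) (x : k), s • x = ε s * x)
    [Module (S ⧸ I) k] (hQ : ∀ (s : S ⧸ I) (x : k),
      s • x = Ideal.Quotient.lift I ε.toRingHom hIε s * x)
    (Kres : MinGradedFreeRes S (fun m => (𝒜 m : Set S)) k)
    (hlin : ∀ (i : ℕ) (j : ℤ), Kres.β i j ≠ 0 → j = (i : ℤ))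
    (Rres : MinGradedFreeRes S (fun m => (𝒜 m : Set S)) (S ⧸ I))
    (hR0 : ∀ j : ℤ, Rres.β 0 j = if j = 0 then 1 else 0)
    (kres : MinGradedFreeRes (S ⧸ I)
        (fun m => (Ideal.Quotient.mk I) '' (𝒜 m : Set S)) k)
    (hk0 : ∀ j : ℤ, kres.β 0 j = if j = 0 then 1 else 0)
    (hN : ∀ i : ℕ, 1 ≤ i → i ≤ q → ∀ j : ℤ, Rres.β i j ≠ 0 → j ≤ (i : ℤ) + 1)
    (i : ℕ) (hi : 1 ≤ i) (hiq : i ≤ q + 1) (j : ℤ) (hj : kres.β i j ≠ 0) : j = (i : ℤ) := by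
  have hES := KK_E 𝒜 Kres hlin (fun m hm s hs x => by rw [hS, hε m hm s hs, zero_mul])
  have hne : Nonempty ((KK 𝒜 Kres hlin).ι 0) := by
    by_contra hcon
    rw [not_nonempty_iff] at hcon
    obtain ⟨y, hy⟩ := Kres.augSurj 1
    have : y = 0 := by
      ext t; exact hcon.elim t
    rw [this, map_zero] at hy
    exact zero_ne_one hy
  -- R over S
  have hER : ∀ m e, m ≤ q → 1 < e → (KK 𝒜 Kres hlin).E (GQ 𝒜 I hI).gr m e := by
    obtain ⟨t0, ht0, ht⟩ := idx_unique _ hR0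
    have hs := ses_zero (S := S) Rres (GS 𝒜) (GQ 𝒜 I hI).gr
      ((Algebra.linearMap S (S ⧸ I)).comp (Finsupp.lapply t0)) (by
        intro y
        rw [aug_eq Rres.aug t0 ht y]
        obtain ⟨y1, hy1⟩ := Rres.augSurj 1
        rw [aug_eq Rres.aug t0 ht y1] at hy1
        set u := Rres.aug (Finsupp.single t0 1)
        rw [Algebra.smul_def] at hy1 ⊢
        change algebraMap S (S ⧸ I) (y t0) = 0 ↔ _
        constructor
        · intro h; rw [h, zero_mul]
        · intro h
          calc algebraMap S (S ⧸ I) (y t0)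
              = algebraMap S (S ⧸ I) (y t0) * (algebraMap S (S ⧸ I) (y1 t0) * u) := by
                rw [hy1, mul_one]
            _ = algebraMap S (S ⧸ I) (y1 t0) * (algebraMap S (S ⧸ I) (y t0) * u) := by ring
            _ = 0 := by rw [h, mul_zero]) (by
        intro n y hy
        have := hy t0
        rw [ht0, sub_zero] at this
        exact ⟨_, this, rfl⟩) (by
        rintro n _ ⟨x, hx, rfl⟩
        refine ⟨Finsupp.single t0 x, fgr_single _ t0 ht0 ht n x hx, ?_⟩
        simp)
    intro m e hm he
    cases m with
    | zero =>
      refine KD.E_image _ hs e (E_free _ _ _ (Rres.finβ 0) 0 e fun j hj => hES _ _ (Or.inr ?_))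
      rw [hR0] at hj
      have : j = 0 := by by_contra h; simp [h] at hj
      omega
    | succ m =>
      refine KD.L1 _ hs (GM_fgr _ (GM_S 𝒜) _) m e
        (E_free _ _ _ (Rres.finβ 0) _ e fun j hj => hES _ _ (Or.inl (by omega)))
        (ind_R Rres (GS 𝒜) _ (Hgr_S 𝒜 Rres) (GM_S 𝒜) hES m 0 _ ?_)
      by_contra hcon
      have := hN (0 + m + 1) (by omega) (by omega) _ hcon
      push_cast at this
      omega
  have hε' : ∀ m, 1 ≤ m → ∀ x ∈ (Ideal.Quotient.mk I) '' (𝒜 m : Set S),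
      Ideal.Quotient.lift I ε.toRingHom hIε x = 0 := by
    rintro m hm _ ⟨x, hx, rfl⟩
    exact hε m hm x hx
  have hk0' : ∀ j, kres.β 0 j ≠ 0 → j = 0 := by
    intro j hj
    rw [hk0] at hj
    by_contra h; simp [h] at hj
  have hlow := lower kres _ hε' hk0' i j hj
  refine le_antisymm ?_ hlow
  by_contra hcon
  obtain ⟨t0, ht0, ht⟩ := idx_unique _ hk0
  let g : FreeMod (S ⧸ I) (kres.β 0) →ₗ[S] k :=
    { toFun := fun y => Ideal.Quotient.lift I ε.toRingHom hIε (y t0)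
      map_add' := fun x y => by simp
      map_smul' := fun s y => by
        rw [RingHom.id_apply, hS, Finsupp.smul_apply, Algebra.smul_def, map_mul]
        rfl }
  have hg : ∀ y, g y = Ideal.Quotient.lift I ε.toRingHom hIε (y t0) := fun y => rfl
  have hs := ses_zero (S := S) kres (GQ 𝒜 I hI) (fun n => if n = 0 then ⊤ else ⊥) g (by
      intro y
      rw [aug_eq kres.aug t0 ht y]
      obtain ⟨y1, hy1⟩ := kres.augSurj 1
      rw [aug_eq kres.aug t0 ht y1, hQ] at hy1
      rw [hQ, hg, mul_eq_zero, or_iff_left]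
      intro h
      rw [h, mul_zero] at hy1
      exact zero_ne_one hy1) (by
      intro n y hy
      by_cases hn : n = 0
      · simp [hn]
      · have h1 := hy t0
        rw [ht0, sub_zero] at h1
        obtain ⟨x, hx, hxy⟩ := h1
        rw [if_neg hn, AddSubgroup.mem_bot, hg, ← hxy]
        change ε x = 0
        rcases int_cases n with ⟨n, rfl⟩ | h
        · exact hε n (by omega) x ((zgr_nat 𝒜 n x).1 hx)
        · rw [zgr_neg 𝒜 n h x hx, map_zero]) (by
      intro n y hy
      by_cases hn : n = 0
      · subst hn
        refine ⟨Finsupp.single t0 (Ideal.Quotient.mk I (algebraMap k S y)),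
          fgr_single _ t0 ht0 ht 0 _ ⟨_, ?_, rfl⟩, ?_⟩
        · exact (zgr_nat 𝒜 0 _).2 (SetLike.algebraMap_mem_graded 𝒜 y)
        · rw [hg, Finsupp.single_eq_same]
          change ε (algebraMap k S y) = y
          simp
      · rw [if_neg hn, AddSubgroup.mem_bot] at hy
        exact ⟨0, AddSubgroup.zero_mem _, by rw [hy, map_zero]⟩)
  obtain ⟨i, rfl⟩ : ∃ i', i = i' + 1 := ⟨i - 1, by omega⟩
  have hmain := main_ind (GQ 𝒜 I hI) _ hne kres _ hε' (Hgr_Q 𝒜 I hI kres) (GM_Q 𝒜 I hI) q hER hk0'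
    _ g hs (by
      intro n hn x hx
      rw [if_neg hn.ne'] at hx
      simpa using hx) i 0 j (by omega) (by push_cast at hcon; omega)
  exact hj (beta_zero (GQ 𝒜 I hI) _ hne kres _ hε' (Hgr_Q 𝒜 I hI kres) i j hmain)


/-- Let `S` be a standard graded Koszul algebra over `k` and `R = S/I`, where
`I` contains no linear forms, with `reg_q^S(R) ≤ 1` for some `q ≥ 1` (condition `N_q`).
Then `t_i^R(k) = i` for `1 ≤ i ≤ q + 1`, i.e. `Tor_i^R(k,k)` is concentrated in degree `i`
for `i ≤ q + 1`; in particular `reg_{q+1}^R(k) = 0`. -/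
theorem tor_concentrated_of_Nq
    (k : Type) [Field k] (S : Type) [CommRing S] [Algebra k S]
    (𝒜 : ℕ → Submodule k S) [GradedAlgebra 𝒜]
    (hstd : ∀ m, 𝒜 (m + 1) = 𝒜 m * 𝒜 1)
    (ε : S →ₐ[k] k) (hε : ∀ m, 1 ≤ m → ∀ x ∈ 𝒜 m, ε x = 0)
    (I : Ideal S) (hI : Ideal.IsHomogeneous 𝒜 I)
    (hIε : ∀ a ∈ I, ε a = 0)
    (hIlin : ∀ x ∈ I, x ∈ 𝒜 1 → x = 0)
    (q : ℕ) (hq : 1 ≤ q) :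
    letI : Module S k := Module.compHom k ε.toRingHom
    letI : Module (S ⧸ I) k :=
      Module.compHom k (Ideal.Quotient.lift I ε.toRingHom hIε)
    ∀ (Kres : MinGradedFreeRes S (fun m => (𝒜 m : Set S)) k),
      (∀ (i : ℕ) (j : ℤ), Kres.β i j ≠ 0 → j = (i : ℤ)) →
    ∀ (Rres : MinGradedFreeRes S (fun m => (𝒜 m : Set S)) (S ⧸ I)),
      (∀ j : ℤ, Rres.β 0 j = if j = 0 then 1 else 0) →
    ∀ (kres : MinGradedFreeRes (S ⧸ I)
        (fun m => (Ideal.Quotient.mk I) '' (𝒜 m : Set S)) k),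
      (∀ j : ℤ, kres.β 0 j = if j = 0 then 1 else 0) →
      (∀ i : ℕ, 1 ≤ i → i ≤ q → ∀ j : ℤ, Rres.β i j ≠ 0 → j ≤ (i : ℤ) + 1) →
    ∀ i : ℕ, 1 ≤ i → i ≤ q + 1 → ∀ j : ℤ, kres.β i j ≠ 0 → j = (i : ℤ) := by
  intro Kres hlin Rres hR0 kres hk0 hN i hi hiq j hj
  letI : Module S k := Module.compHom k ε.toRingHom
  letI : Module (S ⧸ I) k :=
    Module.compHom k (Ideal.Quotient.lift I ε.toRingHom hIε)
  exact core k S 𝒜 ε hε I hI hIε q (fun _ _ => rfl) (fun _ _ => rfl) Kres hlin Rres hR0 kres hk0 hN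
    i hi hiq j hj
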